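/- Let K, N ≥ 1 and t ≥ 1 be natural numbers and γ ≥ 0 a real constant. For each k ∈ {1,…,K} let f_k : ℕ → ℝ satisfy 0 ≤ f_k(c) ≤ γ·c for all c ∈ ℕ. Let n : {1,…,K} → ℕ with n_k ≥ 1 for all k, let μ̂_k, μ_k ∈ ℝ with |μ̂_k − μ_k| ≤ b_k where b_k := √(2·log(t)/n_k), and set U_k := μ̂_k + b_k. Let ĉ : {1,…,K} → ℕ be an allocation with Σ_k ĉ_k = N maximizing Σ_{k=1}^K f_k(c_k)·U_k over all allocations c with Σ_k c_k = N, let c* be any allocation with Σ_k c*_k = N, and let n_min := min{ n_k : ĉ_k > 0 } (assuming N ≥ 1 so this set is nonempty). Then Σ_{k=1}^K (f_k(c*_k) − f_k(ĉ_k))·μ_k ≤ 2·γ·N·√(2·log(t)/n_min). -/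

import Mathlib

open Finset

/-- Combined per-time-step exploitation-phase regret bound: under the good event
`|μ̂ k - μ k| ≤ b k` with `b k = √(2 log t / n k)` and `U k = μ̂ k + b k`, if `ĉ`
maximizes the UCB objective among allocations summing to `N`, then the regret of
`ĉ` against any allocation `c*` is at most `2 γ N √(2 log t / n_min)`, where
`n_min` is the minimal sample count among arms occupied by `ĉ`. -/
theorem stmt_7 (K N t : ℕ) (hK : 1 ≤ K) (hN : 1 ≤ N) (ht : 1 ≤ t)
    (γ : ℝ) (hγ : 0 ≤ γ)
    (f : Fin K → ℕ → ℝ)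
    (hf : ∀ k : Fin K, ∀ c : ℕ, 0 ≤ f k c ∧ f k c ≤ γ * c)
    (n : Fin K → ℕ) (hn : ∀ k, 1 ≤ n k)
    (μhat μ : Fin K → ℝ) (b U : Fin K → ℝ)
    (hb : ∀ k, b k = Real.sqrt (2 * Real.log t / n k))
    (hU : ∀ k, U k = μhat k + b k)
    (hgood : ∀ k, |μhat k - μ k| ≤ b k)
    (chat : Fin K → ℕ) (hchat : ∑ k : Fin K, chat k = N)
    (hmax : ∀ c : Fin K → ℕ, ∑ k : Fin K, c k = N →
      ∑ k : Fin K, f k (c k) * U k ≤ ∑ k : Fin K, f k (chat k) * U k)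
    (cstar : Fin K → ℕ) (hcstar : ∑ k : Fin K, cstar k = N)
    (nmin : ℕ)
    (hne : (Finset.univ.filter (fun k : Fin K => 0 < chat k)).Nonempty)
    (hnmin : nmin = (Finset.univ.filter (fun k : Fin K => 0 < chat k)).inf' hne n) :
    ∑ k : Fin K, (f k (cstar k) - f k (chat k)) * μ k
      ≤ 2 * γ * N * Real.sqrt (2 * Real.log t / nmin) := by
  have hpos : 0 < nmin := by
    rw [hnmin, Finset.lt_inf'_iff]
    intro k _
    exact hn k
  set S := Real.sqrt (2 * Real.log t / nmin) with hS
  have h1 : ∑ k : Fin K, f k (cstar k) * μ k ≤ ∑ k : Fin K, f k (cstar k) * U k := by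
    apply Finset.sum_le_sum
    intro k _
    apply mul_le_mul_of_nonneg_left _ (hf k _).1
    have h := abs_le.1 (hgood k)
    rw [hU k]
    linarith [h.1]
  have h2 := hmax cstar hcstar
  have h3 : ∑ k : Fin K, f k (chat k) * U k
      ≤ ∑ k : Fin K, (f k (chat k) * μ k + 2 * γ * S * (chat k : ℝ)) := by
    apply Finset.sum_le_sum
    intro k _
    have h := abs_le.1 (hgood k)
    have hUk : U k ≤ μ k + 2 * b k := by
      rw [hU k]
      linarith [h.2]
    have h5 := mul_le_mul_of_nonneg_left hUk (hf k (chat k)).1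
    have hb0 : 0 ≤ b k := by
      rw [hb k]
      exact Real.sqrt_nonneg _
    have h6 := mul_le_mul_of_nonneg_right (hf k (chat k)).2 hb0
    have h7 : γ * (chat k : ℝ) * b k ≤ γ * (chat k : ℝ) * S := by
      rcases Nat.eq_zero_or_pos (chat k) with h0 | h0
      · simp [h0]
      · apply mul_le_mul_of_nonneg_left _ (by positivity)
        have hle : nmin ≤ n k := by
          rw [hnmin]
          exact Finset.inf'_le n (by simp [h0])
        rw [hb k, hS]
        apply Real.sqrt_le_sqrt
        have hlog : 0 ≤ Real.log t := Real.log_nonneg (by exact_mod_cast ht)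
        have hpos' : (0 : ℝ) < nmin := by exact_mod_cast hpos
        have hle' : (nmin : ℝ) ≤ n k := by exact_mod_cast hle
        exact div_le_div_of_nonneg_left (by positivity) hpos' hle'
    linarith
  have hsum : ∑ k : Fin K, (chat k : ℝ) = N := by exact_mod_cast hchat
  rw [Finset.sum_add_distrib, ← Finset.mul_sum, hsum] at h3
  simp only [sub_mul, Finset.sum_sub_distrib]
  linarith
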